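/- arXiv:1706.07329 — 5 statements merged into one kernel-verified Lean document; each statement's English description precedes it below -/
import Mathlib

section
/- Let μ_1,…,μ_r and λ_1,…,λ_s be nonzero complex numbers such that ∑_{i=1}^r μ_i^n = ∑_{j=1}^s λ_j^n for every integer n ≥ 1. Then r = s and there exists a permutation p of {1,…,r} such that μ_i = λ_{p(i)} for all i. -/
theorem List.sum_map_polynomial_eval {R : Type*} [CommSemiring R] (l : List R)
    (p : Polynomial R) :
    (l.map fun x => p.eval x).sum = p.sum fun n c => c * (l.map (· ^ n)).sum := by
  induction l with
  | nil => simp [Polynomial.sum_def]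
  | cons a l ih =>
    rw [List.map_cons, List.sum_cons, ih, Polynomial.eval_eq_sum]
    simp only [List.map_cons, List.sum_cons, mul_add, Polynomial.sum_def, Finset.sum_add_distrib]

theorem List.sum_map_eq_count_mul {α R : Type*} [DecidableEq α] [NonAssocSemiring R]
    (l : List α) (f : α → R) (a : α) (hf : ∀ x ∈ l, x ≠ a → f x = 0) :
    (l.map f).sum = l.count a * f a := by
  induction l with
  | nil => simp
  | cons b l ih =>
    have ih' := ih fun x hx => hf x (List.mem_cons_of_mem _ hx)
    by_cases hb : b = a
    · subst hb
      simp [ih', add_mul, add_comm]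
    · simp [ih', hb, hf b List.mem_cons_self hb]

/-- Two lists of elements of a domain of characteristic zero whose positive power sums
agree contain every nonzero element equally often. -/
theorem List.count_eq_of_sum_map_pow_eq {R : Type*} [CommRing R] [IsDomain R] [CharZero R]
    [DecidableEq R] (l₁ l₂ : List R)
    (h : ∀ n : ℕ, 1 ≤ n → (l₁.map (· ^ n)).sum = (l₂.map (· ^ n)).sum) {a : R} (ha : a ≠ 0) :
    l₁.count a = l₂.count a := by
  let p : Polynomial R :=
    Polynomial.X * ∏ b ∈ (l₁ ++ l₂).toFinset.erase a, (Polynomial.X - Polynomial.C b)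
  have eval_p (x : R) : p.eval x = x * ∏ b ∈ (l₁ ++ l₂).toFinset.erase a, (x - b) := by
    simp [p, Polynomial.eval_prod]
  have p_root (x : R) (hx : x ∈ l₁ ++ l₂) (hxa : x ≠ a) : p.eval x = 0 := by
    rw [eval_p, Finset.prod_eq_zero (i := x) (by simpa [hxa] using hx) (sub_self x), mul_zero]
  have p_ne : p.eval a ≠ 0 := by
    rw [eval_p]
    refine mul_ne_zero ha (Finset.prod_ne_zero_iff.mpr fun b hb => ?_)
    exact sub_ne_zero.mpr (Finset.ne_of_mem_erase hb).symm
  have sum_eq : (l₁.map fun x => p.eval x).sum = (l₂.map fun x => p.eval x).sum := by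
    rw [List.sum_map_polynomial_eval, List.sum_map_polynomial_eval]
    refine Finset.sum_congr rfl fun n _ => ?_
    rcases n.eq_zero_or_pos with rfl | hn
    · simp [p]
    · simp only [h n hn]
  rw [List.sum_map_eq_count_mul l₁ _ a fun x hx => p_root x (List.mem_append_left _ hx),
    List.sum_map_eq_count_mul l₂ _ a fun x hx => p_root x (List.mem_append_right _ hx)] at sum_eq
  exact_mod_cast mul_right_cancel₀ p_ne sum_eq

/-- **Power sums determine the multiset.**
If `μ_1,…,μ_r` and `λ_1,…,λ_s` are nonzero complex numbers such that
`∑ μ_i ^ n = ∑ λ_j ^ n` for every `n ≥ 1`, then `r = s` and there is a permutation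
matching the `μ`'s with the `λ`'s; this is exactly the statement that the two lists
are permutations of one another. -/
theorem power_sums_perm (μ lam : List ℂ)
    (hμ : ∀ x ∈ μ, x ≠ 0) (hlam : ∀ x ∈ lam, x ≠ 0)
    (h : ∀ n : ℕ, 1 ≤ n → (μ.map (· ^ n)).sum = (lam.map (· ^ n)).sum) :
    μ.length = lam.length ∧ μ.Perm lam := by
  classical
  have hperm : μ.Perm lam := by
    refine List.perm_iff_count.mpr fun a => ?_
    by_cases ha : a = 0
    · rw [List.count_eq_zero_of_not_mem fun hm => hμ a hm ha,
        List.count_eq_zero_of_not_mem fun hm => hlam a hm ha]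
    · exact List.count_eq_of_sum_map_pow_eq μ lam h ha
  exact ⟨hperm.length_eq, hperm⟩
end

section
/- Let A = (A^i)_{i<d_A} be a family of D_A×D_A complex matrices and B = (B^j)_{j<d_B} a family of D_B×D_B complex matrices, and suppose the transfer maps T_A and T_B are both primitive. Then the transfer map of the tensor-product family C = (C^{(i,j)}), where C^{(i,j)} = A^i ⊗ B^j is the Kronecker product (a (D_A·D_B)×(D_A·D_B) matrix), is primitive. -/
open Matrix
open scoped Kronecker ComplexOrder

noncomputable section

/-- The transfer map `T_A : ρ ↦ ∑ i, A i * ρ * (A i)ᴴ` of an MPS tensor. -/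
def transferMap {D : Type*} [Fintype D] {ι : Type*} [Fintype ι]
    (A : ι → Matrix D D ℂ) (ρ : Matrix D D ℂ) : Matrix D D ℂ :=
  ∑ i, A i * ρ * (A i)ᴴ

/-- A tensor is primitive if some iterate of its transfer map sends every nonzero
positive semidefinite matrix to a positive definite matrix. -/
def IsPrimitive {D : Type*} [Fintype D] [DecidableEq D] {ι : Type*} [Fintype ι]
    (A : ι → Matrix D D ℂ) : Prop :=
  ∃ n : ℕ, 1 ≤ n ∧ ∀ ρ : Matrix D D ℂ, ρ.PosSemidef → ρ ≠ 0 →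
    ((transferMap A)^[n] ρ).PosDef

section Transitive

variable {D : Type*} [Fintype D]

/-- A space of matrices is transitive if it moves each nonzero vector to every vector. -/
def IsTransitive (S : Submodule ℂ (Matrix D D ℂ)) : Prop :=
  ∀ v : D → ℂ, v ≠ 0 → ∀ y : D → ℂ, ∃ X ∈ S, X *ᵥ v = y

/-- Every pencil of endomorphisms of a nonzero complex space has a singular member. -/
lemma exists_singular_combination {W : Type*} [AddCommGroup W] [Module ℂ W]
    [FiniteDimensional ℂ W] [Nontrivial W] (P Q : Module.End ℂ W) :
    ∃ a b : ℂ, (a ≠ 0 ∨ b ≠ 0) ∧ ∃ u : W, u ≠ 0 ∧ a • P u + b • Q u = 0 := by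
  by_cases hP : Function.Injective P
  · let e := LinearEquiv.ofInjectiveEndo P hP
    obtain ⟨μ, hμ⟩ := Module.End.exists_eigenvalue (e.symm.toLinearMap ∘ₗ Q : Module.End ℂ W)
    obtain ⟨u, hu⟩ := hμ.exists_hasEigenvector
    refine ⟨-μ, 1, Or.inr one_ne_zero, u, hu.2, ?_⟩
    have h : e.symm (Q u) = μ • u := hu.apply_eq_smul
    rw [LinearEquiv.symm_apply_eq, map_smul] at h
    rw [h]
    simp [e]
  · rw [← LinearMap.ker_eq_bot, Submodule.eq_bot_iff] at hP
    push Not at hP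
    obtain ⟨u, hu, hu0⟩ := hP
    exact ⟨1, 0, Or.inl one_ne_zero, u, hu0, by simp [LinearMap.mem_ker.1 hu]⟩

/-- If the range of `X` is not a line, some nonzero `X * Y * X` with `Y ∈ S` has a larger kernel. -/
lemma IsTransitive.exists_ker_lt {S : Submodule ℂ (Matrix D D ℂ)} (hS : IsTransitive S)
    (X : Matrix D D ℂ) {v x : D → ℂ} (hv : X *ᵥ v ≠ 0)
    (hx : ∀ c : ℂ, X *ᵥ x ≠ c • X *ᵥ v) :
    ∃ Y ∈ S, X * Y * X ≠ 0 ∧ X.mulVecLin.ker < (X * Y * X).mulVecLin.ker := by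
  obtain ⟨Y₁, hY₁, h₁⟩ := hS _ hv v
  obtain ⟨Y₂, hY₂, h₂⟩ := hS _ hv x
  let W := X.mulVecLin.range
  let E (Y : Matrix D D ℂ) : Module.End ℂ W :=
    (X.mulVecLin.rangeRestrict ∘ₗ Y.mulVecLin) ∘ₗ W.subtype
  have : Nontrivial W := ⟨⟨⟨X *ᵥ v, v, rfl⟩, 0, fun h => hv (congrArg Subtype.val h)⟩⟩
  obtain ⟨a, b, hab, ⟨_, t, rfl⟩, hu, h0⟩ := exists_singular_combination (E Y₁) (E Y₂)
  have h0' : a • X *ᵥ Y₁ *ᵥ X *ᵥ t + b • X *ᵥ Y₂ *ᵥ X *ᵥ t = 0 := congrArg Subtype.val h0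
  have hmul (z : D → ℂ) : (X * (a • Y₁ + b • Y₂) * X) *ᵥ z =
      a • X *ᵥ Y₁ *ᵥ X *ᵥ z + b • X *ᵥ Y₂ *ᵥ X *ᵥ z := by
    simp [← mulVec_mulVec, add_mulVec, mulVec_add, smul_mulVec, mulVec_smul]
  refine ⟨a • Y₁ + b • Y₂, S.add_mem (S.smul_mem _ hY₁) (S.smul_mem _ hY₂), fun hzero => ?_, ?_⟩
  · have h := hmul v
    rw [hzero, zero_mulVec, h₁, h₂] at h
    by_cases hb : b = 0
    · subst hb
      have ha : a ≠ 0 := by simpa using hab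
      rw [zero_smul, add_zero] at h
      exact smul_ne_zero ha hv h.symm
    · apply hx (-(b⁻¹ * a))
      have h' : b • X *ᵥ x = -(a • X *ᵥ v) := (neg_eq_of_add_eq_zero_right h.symm).symm
      rw [neg_smul, mul_smul, ← smul_neg, ← h', inv_smul_smul₀ hb]
  · refine lt_of_le_of_ne (fun z hz => ?_) fun heq => ?_
    · have hz' : X *ᵥ z = 0 := hz
      change (X * _ * X) *ᵥ z = 0
      simp [← mulVec_mulVec, hz']
    · have ht : t ∈ X.mulVecLin.ker := heq ▸ (hmul t).trans h0'
      exact hu (Subtype.ext ht)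

variable [DecidableEq D]

lemma exists_eq_dotProduct (f : (D → ℂ) →ₗ[ℂ] ℂ) : ∃ w : D → ℂ, ∀ x, f x = w ⬝ᵥ x := by
  refine ⟨fun i => f (Pi.single i 1), fun x => ?_⟩
  conv_lhs => rw [pi_eq_sum_univ' x]
  simp [dotProduct, mul_comm]

lemma IsTransitive.of_dotProduct {S : Submodule ℂ (Matrix D D ℂ)}
    (h : ∀ v w : D → ℂ, v ≠ 0 → (∀ X ∈ S, w ⬝ᵥ X *ᵥ v = 0) → w = 0) : IsTransitive S := by
  intro v hv y
  let L : Matrix D D ℂ →ₗ[ℂ] (D → ℂ) := (Matrix.mulVecBilin ℂ ℂ).flip v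
  by_contra hy
  have hlt : S.map L < ⊤ := lt_top_iff_ne_top.2 fun htop => by
    obtain ⟨X, hX, rfl⟩ := htop.ge (Submodule.mem_top (x := y))
    exact hy ⟨X, hX, rfl⟩
  obtain ⟨f, hf, hle⟩ := Submodule.exists_le_ker_of_lt_top _ hlt
  obtain ⟨w, hw⟩ := exists_eq_dotProduct f
  have hw0 : w = 0 := h v w hv fun X hX => by
    rw [← hw]
    exact hle ⟨X, hX, rfl⟩
  exact hf (LinearMap.ext fun x => by simp [hw, hw0])

lemma IsTransitive.exists_vecMul {S : Submodule ℂ (Matrix D D ℂ)} (hS : IsTransitive S)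
    {f : D → ℂ} (hf : f ≠ 0) (y : D → ℂ) : ∃ X ∈ S, f ᵥ* X = y := by
  let T : Submodule ℂ (Matrix D D ℂ) := S.map (transposeLinearEquiv D D ℂ ℂ).toLinearMap
  have hT : IsTransitive T := .of_dotProduct fun v w hv h => by
    by_contra hw
    apply hv
    rw [← dotProduct_eq_zero_iff]
    intro z
    obtain ⟨X, hX, rfl⟩ := hS w hw z
    have := h _ ⟨X, hX, rfl⟩
    simpa [mulVec_transpose, dotProduct_mulVec, dotProduct_comm] using this
  obtain ⟨_, ⟨X, hX, rfl⟩, h⟩ := hT f hf y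
  exact ⟨X, hX, by simpa [mulVec_transpose] using h⟩

/-- Some power of a transitive space of matrices contains a rank-one matrix. -/
lemma IsTransitive.exists_vecMulVec_mem_pow [Nonempty D] {S : Submodule ℂ (Matrix D D ℂ)}
    (hS : IsTransitive S) :
    ∃ k : ℕ, ∃ w f : D → ℂ, w ≠ 0 ∧ f ≠ 0 ∧ vecMulVec w f ∈ S ^ k := by
  let N : Set (Matrix D D ℂ) := {X | X ≠ 0 ∧ ∃ k : ℕ, X ∈ S ^ k}
  have hN : N.Nonempty := ⟨1, one_ne_zero, 0, by simp⟩
  obtain ⟨X, ⟨hX0, k, hXk⟩, hmax⟩ :=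
    (InvImage.wf (fun X : Matrix D D ℂ => X.mulVecLin.ker)
      (wellFounded_gt (α := Submodule ℂ (D → ℂ)))).has_min N hN
  obtain ⟨v, hv⟩ : ∃ v, X *ᵥ v ≠ 0 := by
    by_contra! h
    exact hX0 (ext_of_mulVec_single fun i => by rw [h, zero_mulVec])
  have hline (x : D → ℂ) : ∃ c : ℂ, X *ᵥ x = c • X *ᵥ v := by
    by_contra! hx
    obtain ⟨Y, hY, hne, hlt⟩ := hS.exists_ker_lt X hv hx
    refine hmax (X * Y * X) ⟨hne, k + 1 + k, ?_⟩ hlt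
    rw [pow_add, pow_succ]
    exact Submodule.mul_mem_mul (Submodule.mul_mem_mul hXk hY) hXk
  choose c hc using fun i => hline (Pi.single i 1)
  have hX : X = vecMulVec (X *ᵥ v) c := by
    ext i j
    have := congrFun (hc j) i
    simpa [vecMulVec_apply, mul_comm] using this
  refine ⟨k, X *ᵥ v, c, hv, fun h => hX0 ?_, hX ▸ hXk⟩
  rw [hX, h, vecMulVec_zero]

lemma eq_top_of_single_mem {m n : Type*} [Fintype m] [Fintype n] [DecidableEq m] [DecidableEq n]
    {S : Submodule ℂ (Matrix m n ℂ)} (h : ∀ i j, single i j 1 ∈ S) : S = ⊤ := by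
  refine Submodule.eq_top_iff'.2 fun M => ?_
  induction M using Matrix.induction_on' with
  | h_zero => exact S.zero_mem
  | h_add p q hp hq => exact S.add_mem hp hq
  | h_std_basis i j x => simpa [smul_single] using S.smul_mem x (h i j)

/-- All sufficiently high powers of a transitive space of matrices are the full matrix algebra. -/
theorem IsTransitive.exists_pow_eq_top {S : Submodule ℂ (Matrix D D ℂ)} (hS : IsTransitive S) :
    ∃ k : ℕ, ∀ m, k ≤ m → S ^ m = ⊤ := by
  cases isEmpty_or_nonempty D
  · exact ⟨0, fun m _ => Subsingleton.elim _ _⟩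
  obtain ⟨k, w, f, hw, hf, hmem⟩ := hS.exists_vecMulVec_mem_pow
  refine ⟨1 + k + 1, fun m hm => ?_⟩
  induction m, hm using Nat.le_induction with
  | base =>
    refine eq_top_of_single_mem fun i j => ?_
    obtain ⟨Y, hY, hYw⟩ := hS w hw (Pi.single i 1)
    obtain ⟨Z, hZ, hfZ⟩ := hS.exists_vecMul hf (Pi.single j 1)
    rw [single_eq_single_vecMulVec_single, ← hYw, ← hfZ, ← vecMulVec_mul, ← mul_vecMulVec,
      pow_succ, pow_add, pow_one]
    exact Submodule.mul_mem_mul (Submodule.mul_mem_mul hY hmem) hZ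
  | succ m _ ih =>
    refine eq_top_of_single_mem fun i j => ?_
    obtain ⟨Y, hY, hYi⟩ := hS (Pi.single i 1) (by simp) (Pi.single i 1)
    rw [single_eq_single_vecMulVec_single, ← hYi, ← mul_vecMulVec, pow_succ', ih]
    exact Submodule.mul_mem_mul hY Submodule.mem_top

end Transitive

section TransferMap

variable {D ι : Type*} [Fintype D] [Fintype ι] (A : ι → Matrix D D ℂ)

/-- The linear span of the Kraus operators; its `k`-th power is the span of the words of
length `k`. -/
def krausSpan : Submodule ℂ (Matrix D D ℂ) := Submodule.span ℂ (Set.range A)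

lemma Matrix.PosSemidef.transferMap {ρ : Matrix D D ℂ} (hρ : ρ.PosSemidef) :
    (transferMap A ρ).PosSemidef :=
  posSemidef_sum _ fun i _ => hρ.mul_mul_conjTranspose_same (A i)

lemma Matrix.PosSemidef.transferMap_iterate {ρ : Matrix D D ℂ} (hρ : ρ.PosSemidef) (k : ℕ) :
    ((_root_.transferMap A)^[k] ρ).PosSemidef := by
  induction k with
  | zero => exact hρ
  | succ k ih =>
    rw [Function.iterate_succ_apply']
    exact ih.transferMap A

lemma dotProduct_transferMap_mulVec (ρ : Matrix D D ℂ) (w : D → ℂ) :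
    w ⬝ᵥ transferMap A ρ *ᵥ star w = ∑ i, (w ᵥ* A i) ⬝ᵥ ρ *ᵥ star (w ᵥ* A i) := by
  simp [transferMap, sum_mulVec, dotProduct_sum, ← mulVec_mulVec, star_vecMul,
    dotProduct_mulVec]

lemma Matrix.PosSemidef.dotProduct_mulVec_star_nonneg {ρ : Matrix D D ℂ} (hρ : ρ.PosSemidef)
    (w : D → ℂ) : 0 ≤ w ⬝ᵥ ρ *ᵥ star w := by
  simpa using hρ.dotProduct_mulVec_nonneg (star w)

variable [DecidableEq D]

/-- The quadratic form of an iterate of the transfer map vanishes at `w` exactly when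
`ρ` annihilates the images of `w` under all words. -/
lemma Matrix.PosSemidef.dotProduct_transferMap_iterate_eq_zero_iff {ρ : Matrix D D ℂ}
    (hρ : ρ.PosSemidef) (k : ℕ) (w : D → ℂ) :
    w ⬝ᵥ (_root_.transferMap A)^[k] ρ *ᵥ star w = 0 ↔
      ∀ X ∈ krausSpan A ^ k, ρ *ᵥ star (w ᵥ* X) = 0 := by
  induction k generalizing w with
  | zero =>
    have h := hρ.dotProduct_mulVec_zero_iff (star w)
    rw [star_star] at h
    rw [Function.iterate_zero_apply, h]
    constructor
    · intro h0 X hX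
      rw [pow_zero, Submodule.mem_one] at hX
      obtain ⟨c, rfl⟩ := hX
      simp [Algebra.algebraMap_eq_smul_one, vecMul_smul, mulVec_smul, h0]
    · intro h0
      simpa using h0 1 (pow_zero (krausSpan A) ▸ Submodule.one_le.1 le_rfl)
  | succ k ih =>
    rw [Function.iterate_succ_apply', dotProduct_transferMap_mulVec,
      Finset.sum_eq_zero_iff_of_nonneg
        fun i _ => (hρ.transferMap_iterate A k).dotProduct_mulVec_star_nonneg _]
    simp only [Finset.mem_univ, true_imp_iff, ih]
    constructor
    · intro h X hX
      rw [pow_succ'] at hX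
      induction hX using Submodule.mul_induction_on' with
      | mem_mul_mem M hM N hN =>
        induction hM using Submodule.span_induction with
        | mem M hM =>
          obtain ⟨i, rfl⟩ := hM
          simpa using h i N hN
        | zero => simp
        | add M M' _ _ h₁ h₂ => simp [add_mul, vecMul_add, mulVec_add, h₁, h₂]
        | smul c M _ h₁ => simp [vecMul_smul, mulVec_smul, h₁]
      | add M _ N _ h₁ h₂ => simp [vecMul_add, mulVec_add, h₁, h₂]
    · intro h i X hX
      rw [vecMul_vecMul]
      refine h _ ?_
      rw [pow_succ']
      exact Submodule.mul_mem_mul (Submodule.subset_span ⟨i, rfl⟩) hX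

lemma isTransitive_krausSpan_pow {n : ℕ}
    (h : ∀ ρ : Matrix D D ℂ, ρ.PosSemidef → ρ ≠ 0 → ((transferMap A)^[n] ρ).PosDef) :
    IsTransitive (krausSpan A ^ n) := by
  refine .of_dotProduct fun v w hv hvw => ?_
  have hpsd := posSemidef_vecMulVec_self_star v
  have hpd := h _ hpsd (by simp [vecMulVec_eq_zero, hv])
  by_contra hw
  have hpos := hpd.dotProduct_mulVec_pos (star_ne_zero.2 hw)
  rw [star_star] at hpos
  refine hpos.ne' ((hpsd.dotProduct_transferMap_iterate_eq_zero_iff A n w).2 fun X hX => ?_)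
  rw [vecMulVec_mulVec, star_dotProduct_star, ← dotProduct_mulVec, hvw X hX]
  simp

/-- A primitive transfer map has full Kraus span at every large multiple of some length. -/
theorem IsPrimitive.exists_krausSpan_pow_eq_top {A : ι → Matrix D D ℂ} (hA : IsPrimitive A) :
    ∃ n k : ℕ, 1 ≤ n ∧ ∀ m, k ≤ m → krausSpan A ^ (n * m) = ⊤ := by
  obtain ⟨n, hn, h⟩ := hA
  obtain ⟨k, hk⟩ := (isTransitive_krausSpan_pow A h).exists_pow_eq_top
  exact ⟨n, k, hn, fun m hm => by rw [pow_mul, hk m hm]⟩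

theorem isPrimitive_of_krausSpan_pow_eq_top {n : ℕ} (hn : 1 ≤ n) (h : krausSpan A ^ n = ⊤) :
    IsPrimitive A := by
  refine ⟨n, hn, fun ρ hρ hρ0 => ?_⟩
  have hpsd := hρ.transferMap_iterate A n
  refine .of_dotProduct_mulVec_pos hpsd.1 fun x hx => ?_
  refine lt_of_le_of_ne (hpsd.dotProduct_mulVec_nonneg x) fun h0 => hρ0 ?_
  have hx' : star x ≠ 0 := star_ne_zero.2 hx
  have hker := (hρ.dotProduct_transferMap_iterate_eq_zero_iff A n (star x)).1
    (by simpa using h0.symm)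
  have htop : IsTransitive (⊤ : Submodule ℂ (Matrix D D ℂ)) := .of_dotProduct fun v w hv hvw => by
    obtain ⟨i, hi⟩ := Function.ne_iff.1 hv
    ext j
    rw [Pi.zero_apply] at hi
    have h := hvw (single j i 1) trivial
    simpa [single_mulVec_eq, dotProduct_smul, hi] using h
  refine ext_of_mulVec_single fun i => ?_
  obtain ⟨X, -, hX⟩ := htop.exists_vecMul hx' (star (Pi.single i 1))
  rw [zero_mulVec]
  simpa only [hX, star_star] using hker X (h ▸ Submodule.mem_top)

end TransferMap

lemma kronecker_mem_krausSpan_pow {D E ι κ : Type*} [Fintype D] [Fintype E] [Fintype ι] [Fintype κ]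
    [DecidableEq D] [DecidableEq E] (A : ι → Matrix D D ℂ) (B : κ → Matrix E E ℂ) (n : ℕ)
    {X : Matrix D D ℂ} (hX : X ∈ krausSpan A ^ n) {Y : Matrix E E ℂ} (hY : Y ∈ krausSpan B ^ n) :
    X ⊗ₖ Y ∈ krausSpan (fun p : ι × κ => A p.1 ⊗ₖ B p.2) ^ n := by
  let K : Matrix D D ℂ →ₗ[ℂ] Matrix E E ℂ →ₗ[ℂ] Matrix (D × E) (D × E) ℂ := kroneckerBilinear
  have hK : Submodule.map₂ K (krausSpan A) (krausSpan B) ≤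
      krausSpan (fun p : ι × κ => A p.1 ⊗ₖ B p.2) := by
    rw [krausSpan, krausSpan, Submodule.map₂_span_span]
    refine Submodule.span_mono ?_
    rintro _ ⟨_, ⟨i, rfl⟩, _, ⟨j, rfl⟩, rfl⟩
    exact ⟨(i, j), rfl⟩
  suffices h : Submodule.map₂ K (krausSpan A ^ n) (krausSpan B ^ n) ≤
      krausSpan (fun p : ι × κ => A p.1 ⊗ₖ B p.2) ^ n from h (Submodule.apply_mem_map₂ K hX hY)
  clear hX hY
  induction n with
  | zero =>
    simp only [pow_zero, Submodule.one_eq_span, Submodule.map₂_span_span]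
    refine Submodule.span_mono ?_
    rintro _ ⟨_, rfl, _, rfl, rfl⟩
    exact one_kronecker_one
  | succ n ih =>
    simp only [pow_succ, Submodule.mul_eq_span_mul_set, Submodule.map₂_span_span]
    refine Submodule.span_mono ?_
    rintro _ ⟨_, ⟨X, hX, X', hX', rfl⟩, _, ⟨Y, hY, Y', hY', rfl⟩, rfl⟩
    exact ⟨X ⊗ₖ Y, ih (Submodule.apply_mem_map₂ K hX hY), X' ⊗ₖ Y',
      hK (Submodule.apply_mem_map₂ K hX' hY'), (mul_kronecker_mul X X' Y Y').symm⟩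

/-- **Primitivity is stable under tensor products.**
If the transfer maps of `A` and `B` are primitive, then so is the transfer map of the
tensor-product family `C^{(i,j)} = A^i ⊗ B^j` (Kronecker products). -/
theorem isPrimitive_kronecker {DA DB dA dB : ℕ}
    (A : Fin dA → Matrix (Fin DA) (Fin DA) ℂ)
    (B : Fin dB → Matrix (Fin DB) (Fin DB) ℂ)
    (hA : IsPrimitive A) (hB : IsPrimitive B) :
    IsPrimitive (fun p : Fin dA × Fin dB => A p.1 ⊗ₖ B p.2) := by
  obtain ⟨n, k, hn, hk⟩ := hA.exists_krausSpan_pow_eq_top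
  obtain ⟨m, l, hm, hl⟩ := hB.exists_krausSpan_pow_eq_top
  have hA_top : krausSpan A ^ (n * m * (k + l + 1)) = ⊤ := by
    rw [mul_assoc]
    exact hk _ (by nlinarith)
  have hB_top : krausSpan B ^ (n * m * (k + l + 1)) = ⊤ := by
    rw [mul_comm n m, mul_assoc]
    exact hl _ (by nlinarith)
  have hpos : 1 ≤ n * m * (k + l + 1) := Nat.mul_pos (Nat.mul_pos hn hm) (Nat.succ_pos _)
  refine isPrimitive_of_krausSpan_pow_eq_top _ hpos (eq_top_of_single_mem fun i j => ?_)
  have h := kronecker_mem_krausSpan_pow A B _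
    (hA_top ▸ Submodule.mem_top (x := single i.1 j.1 1))
    (hB_top ▸ Submodule.mem_top (x := single i.2 j.2 1))
  rwa [single_kronecker_single, one_mul] at h
end
end

section
/- Let A be an injective MPS tensor and B an MPS tensor with the same physical dimension d, and let (V,W) be a reduction from B to A. Set N^i = B^i − W A^i V. Then for every m ≥ 1 and all indices i_1,…,i_m ∈ {0,…,d−1}, V N^{i_1} N^{i_2} ⋯ N^{i_m} W = 0. -/
open Matrix

noncomputable section

/-- The ordered product `A^{i_1} ⋯ A^{i_n}` of the matrices of an MPS tensor along
an index string `i`. -/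
def mpsProd {D d : ℕ} (A : Fin d → Matrix (Fin D) (Fin D) ℂ) {n : ℕ}
    (i : Fin n → Fin d) : Matrix (Fin D) (Fin D) ℂ :=
  (List.ofFn fun k => A (i k)).prod

/-- `A` is injective: the only `ρ` with `Tr(A^i ρ) = 0` for all `i` is `ρ = 0`. -/
def InjectiveTensor {D d : ℕ} (A : Fin d → Matrix (Fin D) (Fin D) ℂ) : Prop :=
  ∀ ρ : Matrix (Fin D) (Fin D) ℂ, (∀ i, (A i * ρ).trace = 0) → ρ = 0

theorem mpsProd_eq_prod_map {D d n : ℕ} (A : Fin d → Matrix (Fin D) (Fin D) ℂ)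
    (i : Fin n → Fin d) : mpsProd A i = ((List.ofFn i).map A).prod := by
  rw [mpsProd, List.map_ofFn]
  rfl

/-- If `V B^w W = A^w` for every word `w`, then every word that starts with a nonempty block of
letters of `N^j = B^j − W A^j V` and continues with letters of `B` vanishes between `V` and `W`. -/
theorem mul_prod_sub_mul_prod_mul_eq_zero {DA DB d : ℕ}
    (A : Fin d → Matrix (Fin DA) (Fin DA) ℂ) (B : Fin d → Matrix (Fin DB) (Fin DB) ℂ)
    (V : Matrix (Fin DA) (Fin DB) ℂ) (W : Matrix (Fin DB) (Fin DA) ℂ)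
    (h : ∀ w : List (Fin d), V * (w.map B).prod * W = (w.map A).prod)
    (l : List (Fin d)) (hl : l ≠ []) (w : List (Fin d)) :
    V * (l.map fun j => B j - W * A j * V).prod * (w.map B).prod * W = 0 := by
  have hVW : V * W = 1 := by simpa using h []
  induction l using List.reverseRecOn generalizing w with
  | nil => exact absurd rfl hl
  | append_singleton l j ih =>
    set N : Fin d → Matrix (Fin DB) (Fin DB) ℂ := fun j => B j - W * A j * V with hN
    have key : V * ((l ++ [j]).map N).prod * (w.map B).prod * W =
        V * (l.map N).prod * ((j :: w).map B).prod * W -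
          V * (l.map N).prod * W * (A j * (V * (w.map B).prod * W)) := by
      simp [hN, Matrix.mul_sub, Matrix.sub_mul, Matrix.mul_assoc]
    rw [key, h w]
    rcases eq_or_ne l [] with rfl | hne
    · have hj := h (j :: w)
      simp only [List.map_nil, List.prod_nil, Matrix.mul_one, hVW, Matrix.one_mul, hj]
      simp
    · have hW := ih hne []
      simp only [List.map_nil, List.prod_nil, Matrix.mul_one] at hW
      rw [ih hne, hW]
      simp

/-- **Vanishing of sandwiched products of the nilpotent parts.**
Let `(V, W)` be a reduction from `B` to an injective tensor `A` and set
`N^i = B^i − W A^i V`.  Then `V N^{i_1} ⋯ N^{i_m} W = 0` for every `m ≥ 1`. -/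
theorem reduction_nilpotent_sandwich {DA DB d : ℕ}
    (A : Fin d → Matrix (Fin DA) (Fin DA) ℂ) (B : Fin d → Matrix (Fin DB) (Fin DB) ℂ)
    (hA : InjectiveTensor A)
    (V : Matrix (Fin DA) (Fin DB) ℂ) (W : Matrix (Fin DB) (Fin DA) ℂ)
    (hVW : V * W = 1)
    (hred : ∀ n : ℕ, 1 ≤ n → ∀ i : Fin n → Fin d,
      V * mpsProd B i * W = mpsProd A i) :
    ∀ m : ℕ, 1 ≤ m → ∀ i : Fin m → Fin d,
      V * mpsProd (fun j => B j - W * A j * V) i * W = 0 := by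
  intro m hm i
  have hword : ∀ w : List (Fin d), V * (w.map B).prod * W = (w.map A).prod := by
    intro w
    rcases eq_or_ne w [] with rfl | hw
    · simpa using hVW
    · simpa only [mpsProd_eq_prod_map, List.ofFn_get] using
        hred w.length (List.length_pos_iff.mpr hw) w.get
  have hne : List.ofFn i ≠ [] := by
    rw [Ne, List.ofFn_eq_nil_iff]
    omega
  rw [mpsProd_eq_prod_map]
  simpa using mul_prod_sub_mul_prod_mul_eq_zero A B V W hword (List.ofFn i) hne []
end
end

section
/- Let A and B be MPS tensors with the same physical dimension d such that V_n(B) = V_n(A) for all n ≥ 1, and let (V,W) be a reduction from B to A. Set N^i = B^i − W A^i V. Then the algebra generated by the matrices N^i is nilpotent: there exists N₀ ∈ ℕ such that N^{i_1} N^{i_2} ⋯ N^{i_n} = 0 for every n ≥ N₀ and all indices i_1,…,i_n. -/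
open Matrix

noncomputable section

open Polynomial in
/-- In characteristic zero, an endomorphism all of whose positive powers are traceless is
nilpotent. -/
theorem LinearMap.isNilpotent_of_trace_pow_succ_eq_zero {K M : Type*} [Field K] [CharZero K]
    [AddCommGroup M] [Module K M] [FiniteDimensional K M] (f : Module.End K M)
    (h : ∀ k : ℕ, LinearMap.trace K M (f ^ (k + 1)) = 0) : IsNilpotent f := by
  have trace_aeval (p : K[X]) : LinearMap.trace K M (aeval f (X * p)) = 0 := by
    induction p using Polynomial.induction_on' with
    | add p q hp hq => rw [mul_add, map_add, map_add, hp, hq, add_zero]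
    | monomial n a =>
      rw [X_mul_monomial, aeval_monomial, ← Algebra.smul_def, map_smul, h, smul_zero]
  obtain ⟨q, hq, hndvd⟩ :=
    f.charpoly.exists_eq_pow_rootMultiplicity_mul_and_not_dvd f.charpoly_monic.ne_zero 0
  set m := f.charpoly.rootMultiplicity 0
  rw [C_0, sub_zero] at hq hndvd
  have hcop : IsCoprime (X ^ (m + 1)) q :=
    (irreducible_X.coprime_iff_not_dvd.mpr hndvd).pow_left
  obtain ⟨a, b, hab⟩ := hcop
  have hann (p : K[X]) (hp : f.charpoly ∣ p) : aeval f p = 0 :=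
    aeval_eq_zero_of_dvd_aeval_eq_zero hp f.aeval_self_charpoly
  have hidem : IsIdempotentElem (aeval f (a * X ^ (m + 1))) := by
    rw [IsIdempotentElem, ← map_mul, ← sub_eq_zero, ← map_sub]
    refine hann _ ⟨-(a * b * X), ?_⟩
    rw [hq]
    linear_combination (a * X ^ (m + 1)) * hab
  have hzero : aeval f (a * X ^ (m + 1)) = 0 := by
    refine LinearMap.IsIdempotentElem.eq_zero_of_trace_eq_zero hidem ?_
    rw [show a * X ^ (m + 1) = X * (a * X ^ m) by ring]
    exact trace_aeval _
  refine ⟨m, ?_⟩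
  calc f ^ m = aeval f (X ^ m * (a * X ^ (m + 1)) + X ^ m * (b * q)) := by
        rw [← mul_add, hab]; simp
    _ = 0 := by
        rw [map_add, map_mul, hzero, mul_zero, zero_add]
        exact hann _ ⟨b, by rw [hq]; ring⟩

attribute [local instance] LieRing.ofAssociativeRing in
/-- A non-unital algebra of nilpotent endomorphisms of a finite-dimensional space is nilpotent. -/
theorem NonUnitalSubalgebra.exists_forall_list_prod_eq_zero {K M : Type*} [Field K]
    [AddCommGroup M] [Module K M] [FiniteDimensional K M]
    (S : NonUnitalSubalgebra K (Module.End K M)) (hS : ∀ x ∈ S, IsNilpotent x) :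
    ∃ n₀ : ℕ, ∀ l : List (Module.End K M), (∀ x ∈ l, x ∈ S) → n₀ ≤ l.length → l.prod = 0 := by
  let L : LieSubalgebra K (Module.End K M) :=
    { S.toSubmodule with
      lie_mem' := fun {x y} hx hy => S.sub_mem (S.mul_mem hx hy) (S.mul_mem hy hx) }
  have hL : LieModule.IsNilpotent L M :=
    (LieModule.isNilpotent_iff_forall' (R := K)).mpr fun x => hS x x.2
  obtain ⟨n₀, hn₀⟩ := (LieModule.isNilpotent_iff K L M).mp hL
  refine ⟨n₀, fun l hl hlen => ?_⟩
  have hmem : ∀ l : List (Module.End K M), (∀ x ∈ l, x ∈ S) → ∀ v : M,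
      l.prod v ∈ LieModule.lowerCentralSeries K L M l.length := by
    intro l
    induction l with
    | nil => simp
    | cons x l ih =>
      intro hl v
      rw [List.forall_mem_cons] at hl
      rw [List.length_cons, LieModule.lowerCentralSeries_succ, List.prod_cons]
      exact LieSubmodule.lie_mem_lie (LieSubmodule.mem_top (⟨x, hl.1⟩ : L)) (ih hl.2 v)
  ext v
  have := LieModule.antitone_lowerCentralSeries K L M hlen (hmem l hl v)
  simpa [hn₀] using this

/-- In characteristic zero, if all nonempty words in a family of endomorphisms are traceless,
then all long enough words vanish. -/
theorem LinearMap.exists_forall_word_eq_zero_of_trace_eq_zero {K M ι : Type*} [Field K]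
    [CharZero K] [AddCommGroup M] [Module K M] [FiniteDimensional K M] (f : ι → Module.End K M)
    (h : ∀ l : List ι, l ≠ [] → LinearMap.trace K M (l.map f).prod = 0) :
    ∃ n₀ : ℕ, ∀ l : List ι, n₀ ≤ l.length → (l.map f).prod = 0 := by
  let S := NonUnitalAlgebra.adjoin K (Set.range f)
  have word_of_mem : ∀ x ∈ Subsemigroup.closure (Set.range f),
      ∃ l : List ι, l ≠ [] ∧ (l.map f).prod = x := by
    intro x hx
    induction hx using Subsemigroup.closure_induction with
    | mem x hx =>
      obtain ⟨i, rfl⟩ := hx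
      exact ⟨[i], by simp, by simp⟩
    | mul x y _ _ hx hy =>
      obtain ⟨l, hl, rfl⟩ := hx
      obtain ⟨l', -, rfl⟩ := hy
      exact ⟨l ++ l', by simp [hl], by simp⟩
  have trace_eq_zero : ∀ x ∈ S, LinearMap.trace K M x = 0 := by
    intro x hx
    have hx' : x ∈ Submodule.span K (Subsemigroup.closure (Set.range f) : Set _) := by
      rw [← NonUnitalAlgebra.adjoin_eq_span]
      exact hx
    have hle : Submodule.span K (Subsemigroup.closure (Set.range f) : Set (Module.End K M)) ≤
        LinearMap.ker (LinearMap.trace K M) := by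
      refine Submodule.span_le.mpr fun y hy => ?_
      obtain ⟨l, hl, rfl⟩ := word_of_mem y hy
      exact h l hl
    exact hle hx'
  have pow_mem : ∀ x ∈ S, ∀ k : ℕ, x ^ (k + 1) ∈ S := by
    intro x hx k
    induction k with
    | zero => simpa using hx
    | succ k ih => rw [pow_succ]; exact S.mul_mem ih hx
  obtain ⟨n₀, hn₀⟩ := S.exists_forall_list_prod_eq_zero fun x hx =>
    LinearMap.isNilpotent_of_trace_pow_succ_eq_zero x fun k => trace_eq_zero _ (pow_mem x hx k)
  refine ⟨n₀, fun l hl => hn₀ _ ?_ (by simpa using hl)⟩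
  intro x hx
  obtain ⟨i, -, rfl⟩ := List.mem_map.mp hx
  exact NonUnitalAlgebra.subset_adjoin K ⟨i, rfl⟩

theorem mpsProd_eq_map_prod {D d : ℕ} (A : Fin d → Matrix (Fin D) (Fin D) ℂ) {n : ℕ}
    (i : Fin n → Fin d) : mpsProd A i = ((List.ofFn i).map A).prod := by
  rw [mpsProd, List.map_ofFn]
  rfl

/-- Compressing by a reduction kills every word of the form `B^u N^w B^v` with `w` nonempty,
where `N` is the residual of the reduction. -/
theorem reduction_compress_residual_eq_zero {R ι m n : Type*} [CommRing R] [Fintype m]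
    [DecidableEq m] [Fintype n] [DecidableEq n] (A : ι → Matrix m m R) (B : ι → Matrix n n R)
    (V : Matrix m n R) (W : Matrix n m R)
    (hred : ∀ l : List ι, V * (l.map B).prod * W = (l.map A).prod)
    (w : List ι) (hw : w ≠ []) (u v : List ι) :
    V * (u.map B).prod * (w.map fun j => B j - W * A j * V).prod * (v.map B).prod * W = 0 := by
  induction w generalizing u with
  | nil => exact absurd rfl hw
  | cons j w ih =>
    set N := fun j => B j - W * A j * V
    have hsplit : V * (u.map B).prod * ((j :: w).map N).prod * (v.map B).prod * W =
        V * ((u ++ [j]).map B).prod * (w.map N).prod * (v.map B).prod * W -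
          (V * (u.map B).prod * W) * A j *
            (V * (([] : List ι).map B).prod * (w.map N).prod * (v.map B).prod * W) := by
      simp only [List.map_cons, List.prod_cons, List.map_append, List.prod_append, List.map_nil,
        List.prod_nil, N, Matrix.sub_mul, Matrix.mul_sub, Matrix.mul_assoc,
        mul_one, Matrix.mul_one]
    rw [hsplit]
    by_cases hw' : w = []
    · subst hw'
      have h₁ := hred (u ++ [j] ++ v)
      have h₂ := hred v
      simp only [List.map_cons, List.prod_cons, List.map_append, List.prod_append, List.map_nil,
        List.prod_nil, mul_one, Matrix.mul_one, hred u] at h₁ h₂ ⊢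
      rw [h₂, sub_eq_zero, ← h₁]
      simp only [Matrix.mul_assoc]
    · rw [ih hw', ih hw', Matrix.mul_zero, sub_zero]

/-- If moreover the two tensors generate the same states, then every word `B^u N^w` with `w`
nonempty is traceless. -/
theorem reduction_trace_residual_eq_zero {R ι m n : Type*} [CommRing R] [Fintype m]
    [DecidableEq m] [Fintype n] [DecidableEq n] (A : ι → Matrix m m R) (B : ι → Matrix n n R)
    (V : Matrix m n R) (W : Matrix n m R)
    (hsame : ∀ l : List ι, l ≠ [] → ((l.map B).prod).trace = ((l.map A).prod).trace)
    (hred : ∀ l : List ι, V * (l.map B).prod * W = (l.map A).prod)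
    (w : List ι) (hw : w ≠ []) (u : List ι) :
    ((u.map B).prod * (w.map fun j => B j - W * A j * V).prod).trace = 0 := by
  induction w generalizing u with
  | nil => exact absurd rfl hw
  | cons j w ih =>
    have hcompress := reduction_compress_residual_eq_zero A B V W hred
    set N := fun j => B j - W * A j * V
    have hsplit : ((u.map B).prod * ((j :: w).map N).prod).trace =
        (((u ++ [j]).map B).prod * (w.map N).prod).trace -
          (A j * (V * (([] : List ι).map B).prod * (w.map N).prod * (u.map B).prod * W)).trace := by
      have hcycle : ((u.map B).prod * (W * A j * V * (w.map N).prod)).trace =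
          (A j * (V * (w.map N).prod * (u.map B).prod * W)).trace := by
        calc ((u.map B).prod * (W * A j * V * (w.map N).prod)).trace
            = (((u.map B).prod * W) * (A j * (V * (w.map N).prod))).trace := by
              simp only [Matrix.mul_assoc]
          _ = (A j * (V * (w.map N).prod * (u.map B).prod * W)).trace := by
              rw [Matrix.trace_mul_comm]
              simp only [Matrix.mul_assoc]
      simp only [List.map_nil, List.prod_nil, Matrix.mul_one]
      rw [← hcycle, ← Matrix.trace_sub]
      simp only [List.map_cons, List.prod_cons, List.map_append, List.prod_append, List.map_nil,
        List.prod_nil, mul_one, N, Matrix.sub_mul, Matrix.mul_sub, Matrix.mul_assoc]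
    rw [hsplit]
    by_cases hw' : w = []
    · subst hw'
      have h := hred u
      simp only [List.map_nil, List.prod_nil, Matrix.mul_one, h]
      rw [hsame _ (by simp), Matrix.trace_mul_comm (A j)]
      simp
    · rw [ih hw', hcompress w hw' [] u, Matrix.mul_zero, Matrix.trace_zero, sub_zero]

/-- **Nilpotency of the residual algebra of a reduction.**
If `A` and `B` generate the same states (`V_n(B) = V_n(A)` for all `n ≥ 1`) and
`(V, W)` is a reduction from `B` to `A`, then, setting `N^i = B^i − W A^i V`,
the algebra generated by the `N^i` is nilpotent: all long enough products of the
`N^i` vanish. -/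
theorem reduction_residual_nilpotent {DA DB d : ℕ}
    (A : Fin d → Matrix (Fin DA) (Fin DA) ℂ) (B : Fin d → Matrix (Fin DB) (Fin DB) ℂ)
    (hsame : ∀ n : ℕ, 1 ≤ n → ∀ i : Fin n → Fin d,
      (mpsProd B i).trace = (mpsProd A i).trace)
    (V : Matrix (Fin DA) (Fin DB) ℂ) (W : Matrix (Fin DB) (Fin DA) ℂ)
    (hVW : V * W = 1)
    (hred : ∀ n : ℕ, 1 ≤ n → ∀ i : Fin n → Fin d,
      V * mpsProd B i * W = mpsProd A i) :
    ∃ N₀ : ℕ, ∀ n : ℕ, N₀ ≤ n → ∀ i : Fin n → Fin d,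
      mpsProd (fun j => B j - W * A j * V) i = 0 := by
  have hsame' : ∀ l : List (Fin d), l ≠ [] →
      ((l.map B).prod).trace = ((l.map A).prod).trace := by
    intro l hl
    simpa [mpsProd_eq_map_prod] using hsame l.length (List.length_pos_iff.mpr hl) l.get
  have hred' : ∀ l : List (Fin d), V * (l.map B).prod * W = (l.map A).prod := by
    intro l
    rcases eq_or_ne l [] with rfl | hl
    · simpa using hVW
    · simpa [mpsProd_eq_map_prod] using hred l.length (List.length_pos_iff.mpr hl) l.get
  let N : Fin d → Matrix (Fin DB) (Fin DB) ℂ := fun j => B j - W * A j * V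
  have hmap (l : List (Fin d)) : (l.map fun j => Matrix.toLinAlgEquiv' (N j)).prod =
      Matrix.toLinAlgEquiv' (l.map N).prod := by
    rw [map_list_prod, List.map_map]
    rfl
  obtain ⟨N₀, hN₀⟩ := LinearMap.exists_forall_word_eq_zero_of_trace_eq_zero
    (fun j => Matrix.toLinAlgEquiv' (N j)) fun l hl => by
      rw [hmap]
      refine (Matrix.trace_toLin'_eq _).trans ?_
      simpa using reduction_trace_residual_eq_zero A B V W hsame' hred' l hl []
  refine ⟨N₀, fun n hn i => ?_⟩
  have h := hN₀ (List.ofFn i) (by simpa using hn)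
  rw [hmap, map_eq_zero_iff _ Matrix.toLinAlgEquiv'.injective] at h
  rwa [mpsProd_eq_map_prod]
end
end

section
/- Let A be the MPS tensor with physical dimension 2 and bond dimension 2 given by A^0 = [[1,0],[0,2]] and A^1 = [[24,−10],[17,−3]], and let B be given by B^0 = A^0 and B^1 = −A^1. Then: (a) V_4(A) = V_4(B), i.e., Tr(A^{i_1}A^{i_2}A^{i_3}A^{i_4}) = Tr(B^{i_1}B^{i_2}B^{i_3}B^{i_4}) for all i_1,…,i_4 ∈ {0,1}; (b) V_5(A) ≠ V_5(B), i.e., there exist i_1,…,i_5 ∈ {0,1} with Tr(A^{i_1}⋯A^{i_5}) ≠ Tr(B^{i_1}⋯B^{i_5}); (c) the 2-fold blockings of A and of B are injective; and (d) there is no invertible 2×2 complex matrix X such that X B^{i_1}B^{i_2}B^{i_3}B^{i_4} X^{−1} = A^{i_1}A^{i_2}A^{i_3}A^{i_4} for all i_1,…,i_4 ∈ {0,1}. -/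
open Matrix

noncomputable section

/-- The example tensor `A` with `A^0 = [[1,0],[0,2]]`, `A^1 = [[24,−10],[17,−3]]`. -/
def Aex : Fin 2 → Matrix (Fin 2) (Fin 2) ℂ :=
  ![!![1, 0; 0, 2], !![24, -10; 17, -3]]

/-- The example tensor `B` with `B^0 = A^0`, `B^1 = −A^1`. -/
def Bex : Fin 2 → Matrix (Fin 2) (Fin 2) ℂ :=
  ![!![1, 0; 0, 2], -!![24, -10; 17, -3]]

/-- A `2 × 2` matrix orthogonal, for the trace pairing, to all words of length two in
`diag(1, 2)` and `± [[24, −10], [17, −3]]` has vanishing entries. -/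
theorem eq_zero_of_two_block_equations {ρ : Matrix (Fin 2) (Fin 2) ℂ}
    (h00 : ρ 0 0 + 4 * ρ 1 1 = 0)
    (h01 : 24 * ρ 0 0 - 10 * ρ 1 0 + 34 * ρ 0 1 - 6 * ρ 1 1 = 0)
    (h10 : 24 * ρ 0 0 - 20 * ρ 1 0 + 17 * ρ 0 1 - 6 * ρ 1 1 = 0)
    (h11 : 406 * ρ 0 0 - 210 * ρ 1 0 + 357 * ρ 0 1 - 161 * ρ 1 1 = 0) : ρ = 0 := by
  have hr : ρ 1 0 = -(17 / 10) * ρ 0 1 := by linear_combination (h01 - h10) / 10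
  have hq : ρ 0 1 = 2 * ρ 1 1 := by
    linear_combination (h01 - 24 * h00 + 10 * hr) / 51
  have hs : ρ 1 1 = 0 := by
    linear_combination (h11 - 406 * h00 + 210 * hr - 714 * hq) / (-357)
  have hq' : ρ 0 1 = 0 := by rw [hq, hs, mul_zero]
  have hr' : ρ 1 0 = 0 := by rw [hr, hq', mul_zero]
  have hp : ρ 0 0 = 0 := by linear_combination h00 - 4 * hs
  ext i j
  fin_cases i <;> fin_cases j <;> assumption

/-- **A symmetry at size 4 that is broken at size 5.**
(a) `V_4(A) = V_4(B)`;
(b) `V_5(A) ≠ V_5(B)`;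
(c) the 2-fold blockings of `A` and `B` are injective;
(d) no invertible `X` satisfies `X B^{i_1}B^{i_2}B^{i_3}B^{i_4} X⁻¹ = A^{i_1}A^{i_2}A^{i_3}A^{i_4}`
for all index strings of length 4. -/
theorem example_size_four_symmetry :
    (∀ i : Fin 4 → Fin 2, (mpsProd Aex i).trace = (mpsProd Bex i).trace) ∧
    (∃ i : Fin 5 → Fin 2, (mpsProd Aex i).trace ≠ (mpsProd Bex i).trace) ∧
    (∀ ρ : Matrix (Fin 2) (Fin 2) ℂ,
      (∀ i : Fin 2 → Fin 2, (mpsProd Aex i * ρ).trace = 0) → ρ = 0) ∧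
    (∀ ρ : Matrix (Fin 2) (Fin 2) ℂ,
      (∀ i : Fin 2 → Fin 2, (mpsProd Bex i * ρ).trace = 0) → ρ = 0) ∧
    ¬ ∃ X : Matrix (Fin 2) (Fin 2) ℂ, IsUnit X ∧
        ∀ i : Fin 4 → Fin 2, X * mpsProd Bex i * X⁻¹ = mpsProd Aex i := by
  refine ⟨fun i => ?_, ⟨![0, 0, 0, 0, 1], ?_⟩, fun ρ h => ?_, fun ρ h => ?_, ?_⟩
  · obtain ⟨a, b, c, d, rfl⟩ : ∃ a b c d, i = ![a, b, c, d] :=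
      ⟨i 0, i 1, i 2, i 3, by ext k; fin_cases k <;> rfl⟩
    fin_cases a <;> fin_cases b <;> fin_cases c <;> fin_cases d <;>
      norm_num [mpsProd, Aex, Bex, List.ofFn_succ, Matrix.trace_fin_two]
  · norm_num [mpsProd, Aex, Bex, List.ofFn_succ, Matrix.trace_fin_two]
  · have h00 := h ![0, 0]
    have h01 := h ![0, 1]
    have h10 := h ![1, 0]
    have h11 := h ![1, 1]
    simp [mpsProd, Aex, List.ofFn_succ, Matrix.trace_fin_two, Matrix.vecMul,
      dotProduct, Fin.sum_univ_two] at h00 h01 h10 h11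
    apply eq_zero_of_two_block_equations
    · linear_combination h00
    · linear_combination h01
    · linear_combination h10
    · linear_combination h11
  · have h00 := h ![0, 0]
    have h01 := h ![0, 1]
    have h10 := h ![1, 0]
    have h11 := h ![1, 1]
    simp [mpsProd, Bex, List.ofFn_succ, Matrix.trace_fin_two, Matrix.vecMul,
      dotProduct, Fin.sum_univ_two] at h00 h01 h10 h11
    apply eq_zero_of_two_block_equations
    · linear_combination h00
    · linear_combination -h01
    · linear_combination -h10
    · linear_combination h11
  · rintro ⟨X, hX, h⟩
    have hdet : IsUnit X.det := (Matrix.isUnit_iff_isUnit_det X).mp hX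
    have hcomm (i : Fin 4 → Fin 2) : X * mpsProd Bex i = mpsProd Aex i * X := by
      rw [← h i, Matrix.nonsing_inv_mul_cancel_right _ _ hdet]
    have h0 := hcomm ![0, 0, 0, 0]
    have h1 := hcomm ![0, 0, 0, 1]
    have h01 := congrFun₂ h0 0 1
    have h10 := congrFun₂ h0 1 0
    have h00 := congrFun₂ h1 0 0
    norm_num [mpsProd, Aex, Bex, List.ofFn_succ, Matrix.mul_apply, Fin.sum_univ_two]
      at h01 h10 h00
    have hX01 : X 0 1 = 0 := by linear_combination h01 / 15
    have hX10 : X 1 0 = 0 := by linear_combination -h10 / 15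
    have hX00 : X 0 0 = 0 := by
      linear_combination -(1 / 48) * (h00 + 136 * hX01 - 10 * hX10)
    apply hdet.ne_zero
    rw [Matrix.det_fin_two, hX00, hX01]
    ring
end
end
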